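/- Let R be a commutative noetherian ring and let A be an étale R-algebra (i.e. A is formally étale and of finite presentation over R; equivalently flat, unramified and of finite presentation). Then the nilradical of A equals the ideal of A generated by the image of the nilradical of R, i.e. nil(A) = nil(R)·A. In particular, if R is reduced then A is reduced. -/

import Mathlib

universe u

open TensorProduct

/-- The canonical map from a reduced ring to the product of the residue fields at its minimal
primes is injective. -/
lemma injective_pi_residueField_minimalPrimes (R : Type*) [CommRing R] [IsReduced R] :
    Function.Injective (algebraMap R
      (∀ p : {p : PrimeSpectrum R // p.asIdeal ∈ minimalPrimes R},
        p.1.asIdeal.ResidueField)) := by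
  rw [injective_iff_map_eq_zero]
  intro x hx
  have hmem : x ∈ sInf (minimalPrimes R) := by
    refine Ideal.mem_sInf.mpr fun {p} hp ↦ ?_
    have : p.IsPrime := Ideal.IsMinimalPrime.isPrime hp
    exact Ideal.algebraMap_residueField_eq_zero.mp (congrFun hx ⟨⟨p, this⟩, hp⟩)
  rw [minimalPrimes, Ideal.sInf_minimalPrimes] at hmem
  exact (mem_nilradical.mp hmem).eq_zero

/-- An étale algebra over a reduced noetherian ring is reduced. -/
lemma Algebra.Etale.isReduced (R A : Type*) [CommRing R] [IsNoetherianRing R] [IsReduced R]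
    [CommRing A] [Algebra R A] [Algebra.Etale R A] : IsReduced A := by
  classical
  let ι := {p : PrimeSpectrum R // p.asIdeal ∈ minimalPrimes R}
  let K (p : ι) := p.1.asIdeal.ResidueField
  have : Finite ι :=
    ((minimalPrimes.finite_of_isNoetherianRing R).preimage
      (f := PrimeSpectrum.asIdeal) (fun _ _ _ _ h ↦ PrimeSpectrum.ext h)).to_subtype
  have := Fintype.ofFinite ι
  have hfiber (p : ι) : IsReduced (A ⊗[R] K p) :=
    have : IsReduced (K p ⊗[R] A) :=
      Algebra.FormallyUnramified.isReduced_of_field (K p) (K p ⊗[R] A)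
    isReduced_of_injective _ (Algebra.TensorProduct.comm R A (K p)).injective
  have hpi : IsReduced (∀ p, A ⊗[R] K p) := by
    refine ⟨fun x hx ↦ funext fun p ↦ ?_⟩
    exact (hx.map (Pi.evalRingHom _ p)).eq_zero
  have : IsReduced (A ⊗[R] ∀ p, K p) :=
    isReduced_of_injective _ (Algebra.TensorProduct.piRight R A A K).injective
  exact isReduced_of_injective
    (Algebra.TensorProduct.includeLeft : A →ₐ[R] A ⊗[R] ∀ p, K p)
    (Algebra.TensorProduct.includeLeft_injective (injective_pi_residueField_minimalPrimes R))

/-- The nilradical commutes with étale extension of a noetherian ring. -/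
lemma Algebra.Etale.nilradical_eq_map (R A : Type*) [CommRing R] [IsNoetherianRing R]
    [CommRing A] [Algebra R A] [Algebra.Etale R A] :
    nilradical A = (nilradical R).map (algebraMap R A) := by
  apply le_antisymm
  · have : IsReduced (R ⧸ nilradical R) :=
      (Ideal.isRadical_iff_quotient_reduced _).mp (Ideal.radical_isRadical _)
    have := Algebra.Etale.isReduced (R ⧸ nilradical R) ((R ⧸ nilradical R) ⊗[R] A)
    have : IsReduced (A ⊗[R] (R ⧸ nilradical R)) :=
      isReduced_of_injective _ (Algebra.TensorProduct.comm R A (R ⧸ nilradical R)).injective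
    have : IsReduced (A ⧸ (nilradical R).map (algebraMap R A)) :=
      isReduced_of_injective _
        (Algebra.TensorProduct.quotIdealMapEquivTensorQuot A (nilradical R)).injective
    intro x hx
    exact (Ideal.isRadical_iff_quotient_reduced _).mpr this
      (Ideal.radical_mono bot_le hx)
  · exact Ideal.map_le_iff_le_comap.mpr fun x hx ↦
      mem_nilradical.mpr ((mem_nilradical.mp hx).map (algebraMap R A))

/-- **Proposition 4.4 (étale maps and nilradicals).** If `R` is a commutative noetherian
ring and `A` is an étale `R`-algebra, then the nilradical of `A` is the ideal generated
by the image of the nilradical of `R`; in particular, if `R` is reduced then so is `A`. -/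
theorem stmt_14 {R A : Type u} [CommRing R] [IsNoetherianRing R] [CommRing A]
    [Algebra R A] [Algebra.Etale R A] :
    nilradical A = Ideal.map (algebraMap R A) (nilradical R) ∧
    (IsReduced R → IsReduced A) := by
  exact ⟨Algebra.Etale.nilradical_eq_map R A, fun _ ↦ Algebra.Etale.isReduced R A⟩
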